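/- Let m > 0 and 0 < a < b < ∞. The kernel K(x,y) := ∫_a^b k_m(s(x−y))/s ds on ℝ² × ℝ² is continuous and of positive type: for every n ∈ ℕ, points x₁,…,xₙ ∈ ℝ² and reals a₁,…,aₙ, Σ_{i=1}^n Σ_{j=1}^n a_i a_j K(x_i, x_j) ≥ 0. -/

import Mathlib

open MeasureTheory

/-- `k_m(z) = (1/2) ∫₀^∞ e^{−(m²/(2s))‖z‖² − s/2} ds`. -/
noncomputable def km (m : ℝ) (z : EuclideanSpace ℝ (Fin 2)) : ℝ :=
  (1 / 2) * ∫ s in Set.Ioi (0 : ℝ), Real.exp (-(m ^ 2 / (2 * s)) * ‖z‖ ^ 2 - s / 2)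

section GaussianKernel

variable {V : Type*} [NormedAddCommGroup V] [InnerProductSpace ℝ V]

theorem exp_neg_mul_sq_norm_sub_mul_exp (t : ℝ) (x y z : V) :
    Real.exp (-(2 * t) * ‖z - x‖ ^ 2) * Real.exp (-(2 * t) * ‖z - y‖ ^ 2) =
      Real.exp (-t * ‖x - y‖ ^ 2) *
        Real.exp (-(4 * t) * ‖z - (1 / 2 : ℝ) • (x + y)‖ ^ 2) := by
  rw [← Real.exp_add, ← Real.exp_add]
  congr 1
  simp only [@norm_sub_sq_real, norm_smul, mul_pow, @norm_add_sq_real, inner_smul_right,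
    inner_add_right]
  norm_num
  ring

variable [FiniteDimensional ℝ V] [MeasurableSpace V] [BorelSpace V]

theorem integrable_exp_neg_mul_sq_norm_sub {t : ℝ} (ht : 0 < t) (w : V) :
    Integrable (fun z : V => Real.exp (-t * ‖z - w‖ ^ 2)) := by
  have h := (GaussianFourier.integrable_cexp_neg_mul_sq_norm_add (V := V) (b := (t : ℂ))
    (by simpa using ht) 0 0).re
  have h' : Integrable (fun z : V => Real.exp (-t * ‖z‖ ^ 2)) := by
    refine h.congr (Filter.Eventually.of_forall fun z => ?_)
    simp only [zero_mul, add_zero, RCLike.re_eq_complex_re]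
    norm_cast
  exact h'.comp_sub_right w

/-- The Gaussian kernel is of positive type. -/
theorem sum_mul_exp_neg_mul_sq_norm_sub_nonneg {ι : Type*} [Fintype ι] {t : ℝ} (ht : 0 < t)
    (x : ι → V) (c : ι → ℝ) :
    0 ≤ ∑ i, ∑ j, c i * c j * Real.exp (-t * ‖x i - x j‖ ^ 2) := by
  have hint (w : V) : Integrable (fun z : V => Real.exp (-(4 * t) * ‖z - w‖ ^ 2)) :=
    integrable_exp_neg_mul_sq_norm_sub (by positivity) w
  set C : ℝ := ∫ z : V, Real.exp (-(4 * t) * ‖z‖ ^ 2) with hC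
  have hCpos : 0 < C := by
    have h0 := hint 0
    simp only [sub_zero] at h0
    exact integral_exp_pos h0
  have hsq : ∫ z : V, (∑ i, c i * Real.exp (-(2 * t) * ‖z - x i‖ ^ 2)) ^ 2 =
      (∑ i, ∑ j, c i * c j * Real.exp (-t * ‖x i - x j‖ ^ 2)) * C := by
    have hexp (z : V) : (∑ i, c i * Real.exp (-(2 * t) * ‖z - x i‖ ^ 2)) ^ 2 =
        ∑ i, ∑ j, c i * c j * Real.exp (-t * ‖x i - x j‖ ^ 2) *
          Real.exp (-(4 * t) * ‖z - (1 / 2 : ℝ) • (x i + x j)‖ ^ 2) := by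
      rw [sq, Finset.sum_mul_sum]
      refine Finset.sum_congr rfl fun i _ => Finset.sum_congr rfl fun j _ => ?_
      rw [mul_mul_mul_comm, exp_neg_mul_sq_norm_sub_mul_exp, mul_assoc (c i * c j)]
    simp_rw [hexp]
    rw [integral_finsetSum _ fun i _ => integrable_finsetSum _ fun j _ => (hint _).const_mul _,
      Finset.sum_mul]
    refine Finset.sum_congr rfl fun i _ => ?_
    rw [integral_finsetSum _ fun j _ => (hint _).const_mul _, Finset.sum_mul]
    refine Finset.sum_congr rfl fun j _ => ?_
    rw [integral_const_mul,
      integral_sub_right_eq_self (fun z : V => Real.exp (-(4 * t) * ‖z‖ ^ 2))]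
  exact nonneg_of_mul_nonneg_left (hsq ▸ integral_nonneg fun z => sq_nonneg _) hCpos

end GaussianKernel

theorem integrableOn_exp_neg_half : IntegrableOn (fun s : ℝ => Real.exp (-s / 2)) (Set.Ioi 0) := by
  refine (integrableOn_exp_mul_Ioi (a := -1 / 2) (by norm_num) 0).congr_fun (fun s _ => ?_)
    measurableSet_Ioi
  ring_nf

theorem norm_km_integrand_le (m : ℝ) (z : EuclideanSpace ℝ (Fin 2)) :
    ∀ᵐ s ∂volume.restrict (Set.Ioi (0 : ℝ)),
      ‖Real.exp (-(m ^ 2 / (2 * s)) * ‖z‖ ^ 2 - s / 2)‖ ≤ Real.exp (-s / 2) := by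
  filter_upwards [ae_restrict_mem measurableSet_Ioi] with s hs
  have hs : 0 < s := hs
  have h : 0 ≤ m ^ 2 / (2 * s) * ‖z‖ ^ 2 := by positivity
  rw [Real.norm_of_nonneg (Real.exp_nonneg _), Real.exp_le_exp]
  linarith

theorem aestronglyMeasurable_km_integrand (m : ℝ) (z : EuclideanSpace ℝ (Fin 2)) :
    AEStronglyMeasurable (fun s : ℝ => Real.exp (-(m ^ 2 / (2 * s)) * ‖z‖ ^ 2 - s / 2))
      (volume.restrict (Set.Ioi 0)) :=
  Measurable.aestronglyMeasurable (by fun_prop)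

theorem integrableOn_km_integrand (m : ℝ) (z : EuclideanSpace ℝ (Fin 2)) :
    IntegrableOn (fun s : ℝ => Real.exp (-(m ^ 2 / (2 * s)) * ‖z‖ ^ 2 - s / 2)) (Set.Ioi 0) :=
  integrableOn_exp_neg_half.mono' (aestronglyMeasurable_km_integrand m z)
    (norm_km_integrand_le m z)

theorem continuous_km (m : ℝ) : Continuous (km m) := by
  unfold km
  refine continuous_const.mul (continuous_of_dominated (aestronglyMeasurable_km_integrand m)
    (norm_km_integrand_le m) integrableOn_exp_neg_half ?_)
  exact Filter.Eventually.of_forall fun s => by fun_prop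

/-- The kernel `(x, y) ↦ k_m(x - y)` is of positive type. -/
theorem sum_mul_km_sub_nonneg {ι : Type*} [Fintype ι] {m : ℝ} (hm : 0 < m)
    (x : ι → EuclideanSpace ℝ (Fin 2)) (c : ι → ℝ) :
    0 ≤ ∑ i, ∑ j, c i * c j * km m (x i - x j) := by
  have hint (i j : ι) := (integrableOn_km_integrand m (x i - x j)).const_mul (c i * c j)
  have h : ∑ i, ∑ j, c i * c j * km m (x i - x j) =
      (1 / 2) * ∫ s in Set.Ioi (0 : ℝ), ∑ i, ∑ j,
        c i * c j * Real.exp (-(m ^ 2 / (2 * s)) * ‖x i - x j‖ ^ 2 - s / 2) := by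
    rw [integral_finsetSum _ fun i _ => integrable_finsetSum _ fun j _ => hint i j,
      Finset.mul_sum]
    refine Finset.sum_congr rfl fun i _ => ?_
    rw [integral_finsetSum _ fun j _ => hint i j, Finset.mul_sum]
    refine Finset.sum_congr rfl fun j _ => ?_
    rw [integral_const_mul, km]
    ring
  rw [h]
  refine mul_nonneg (by norm_num) (setIntegral_nonneg measurableSet_Ioi fun s hs => ?_)
  have hs : 0 < s := hs
  simp_rw [sub_eq_add_neg _ (s / 2), Real.exp_add, ← mul_assoc, ← Finset.sum_mul]
  exact mul_nonneg (sum_mul_exp_neg_mul_sq_norm_sub_nonneg (by positivity) x c)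
    (Real.exp_nonneg _)

theorem covariance_kernel_continuous_positive_type (m a b : ℝ) (hm : 0 < m)
    (ha : 0 < a) (hab : a < b) :
    Continuous (fun p : EuclideanSpace ℝ (Fin 2) × EuclideanSpace ℝ (Fin 2) =>
        ∫ s in a..b, km m (s • (p.1 - p.2)) / s) ∧
    ∀ (n : ℕ) (x : Fin n → EuclideanSpace ℝ (Fin 2)) (c : Fin n → ℝ),
      0 ≤ ∑ i : Fin n, ∑ j : Fin n, c i * c j * ∫ s in a..b, km m (s • (x i - x j)) / s := by
  have hkm := continuous_km m
  have hmax (s : ℝ) : max a s ≠ 0 := (ha.trans_le (le_max_left a s)).ne'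
  have hcongr (z : EuclideanSpace ℝ (Fin 2)) :
      ∫ s in a..b, km m (s • z) / s = ∫ s in a..b, km m (s • z) / max a s := by
    refine intervalIntegral.integral_congr fun s hs => ?_
    rw [Set.uIcc_of_le hab.le] at hs
    simp only [max_eq_right hs.1]
  simp_rw [hcongr]
  refine ⟨?_, fun n x c => ?_⟩
  · refine intervalIntegral.continuous_parametric_intervalIntegral_of_continuous' ?_ a b
    refine Continuous.div (by fun_prop) (by fun_prop) fun p => hmax p.2
  · have hint (i j : Fin n) : IntervalIntegrable
        (fun s => c i * c j * (km m (s • (x i - x j)) / max a s)) volume a b :=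
      Continuous.intervalIntegrable
        (continuous_const.mul (Continuous.div (by fun_prop) (by fun_prop) hmax)) a b
    have h : ∑ i, ∑ j, c i * c j * ∫ s in a..b, km m (s • (x i - x j)) / max a s =
        ∫ s in a..b, ∑ i, ∑ j, c i * c j * (km m (s • (x i - x j)) / max a s) := by
      have hsum (i : Fin n) := IntervalIntegrable.sum Finset.univ fun j _ => hint i j
      simp only [Finset.sum_fn] at hsum
      rw [intervalIntegral.integral_finsetSum fun i _ => hsum i]
      refine Finset.sum_congr rfl fun i _ => ?_
      rw [intervalIntegral.integral_finsetSum fun j _ => hint i j]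
      simp_rw [intervalIntegral.integral_const_mul]
    rw [h]
    refine intervalIntegral.integral_nonneg hab.le fun s _ => ?_
    simp_rw [← mul_div_assoc, ← Finset.sum_div, smul_sub]
    exact div_nonneg (sum_mul_km_sub_nonneg hm (fun i => s • x i) c)
      (ha.le.trans (le_max_left a s))
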